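/- Let n ≥ 3 and r > 0, and let u be a real-valued function that is continuously differentiable on a neighborhood of the closed ball B̄_r(0) ⊂ ℝⁿ. Then ∫_{B_r} u(x)²/|x|² dx ≤ (2/(n−2)) (1/r) ∫_{∂B_r} u² dS + (4/(n−2)²) ∫_{B_r} |∇u|² dx. -/

import Mathlib

open MeasureTheory

/-- One-dimensional Hardy inequality on `(0, r)` with the weight coming from polar coordinates. -/
theorem radial_hardy_inequality (j : ℕ) {r : ℝ} (hr : 0 < r) {v v' : ℝ → ℝ}
    (hv : ∀ t ∈ Set.Icc 0 r, HasDerivAt v (v' t) t) (hv' : ContinuousOn v' (Set.Icc 0 r)) :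
    ∫ t in Set.Ioo 0 r, t ^ j * v t ^ 2 ≤
      2 / ((j : ℝ) + 1) * (r ^ (j + 1) * v r ^ 2) +
        4 / ((j : ℝ) + 1) ^ 2 * ∫ t in Set.Ioo 0 r, t ^ (j + 2) * v' t ^ 2 := by
  have hvc : ContinuousOn v (Set.Icc 0 r) := fun t ht => (hv t ht).continuousAt.continuousWithinAt
  have hu : Set.uIcc 0 r = Set.Icc 0 r := Set.uIcc_of_le hr.le
  have hA : IntervalIntegrable (fun t => t ^ j * v t ^ 2) volume 0 r := by
    apply ContinuousOn.intervalIntegrable; rw [hu]; fun_prop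
  have hB : IntervalIntegrable (fun t => t ^ (j + 2) * v' t ^ 2) volume 0 r := by
    apply ContinuousOn.intervalIntegrable; rw [hu]; fun_prop
  have hC : IntervalIntegrable (fun t => t ^ (j + 1) * (2 * v t * v' t)) volume 0 r := by
    apply ContinuousOn.intervalIntegrable; rw [hu]; fun_prop
  have hftc : ∫ t in (0 : ℝ)..r, (((j : ℝ) + 1) * (t ^ j * v t ^ 2) +
      t ^ (j + 1) * (2 * v t * v' t)) = r ^ (j + 1) * v r ^ 2 := by
    rw [intervalIntegral.integral_eq_sub_of_hasDerivAt (f := fun t => t ^ (j + 1) * v t ^ 2)]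
    · simp
    · intro t ht
      rw [hu] at ht
      refine ((hasDerivAt_pow (j + 1) t).fun_mul ((hv t ht).fun_pow 2)).congr_deriv ?_
      push_cast
      ring
    · exact (hA.const_mul _).add hC
  have hmono : ∫ t in (0 : ℝ)..r, (((j : ℝ) + 1) / 2 * (t ^ j * v t ^ 2) -
      2 / ((j : ℝ) + 1) * (t ^ (j + 2) * v' t ^ 2)) ≤ r ^ (j + 1) * v r ^ 2 := by
    rw [← hftc]
    apply intervalIntegral.integral_mono_on hr.le ((hA.const_mul _).sub (hB.const_mul _))
      ((hA.const_mul _).add hC)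
    intro t ht
    have hj : (0 : ℝ) < (j : ℝ) + 1 := by positivity
    have key : 0 ≤ t ^ j * (2 / ((j : ℝ) + 1)) * (((j : ℝ) + 1) / 2 * v t + t * v' t) ^ 2 := by
      have := pow_nonneg ht.1 j
      positivity
    have e : t ^ j * (2 / ((j : ℝ) + 1)) * (((j : ℝ) + 1) / 2 * v t + t * v' t) ^ 2 =
        (((j : ℝ) + 1) * (t ^ j * v t ^ 2) + t ^ (j + 1) * (2 * v t * v' t)) -
        (((j : ℝ) + 1) / 2 * (t ^ j * v t ^ 2) -
          2 / ((j : ℝ) + 1) * (t ^ (j + 2) * v' t ^ 2)) := by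
      field_simp
      ring
    linarith
  rw [intervalIntegral.integral_sub (hA.const_mul _) (hB.const_mul _),
    intervalIntegral.integral_const_mul, intervalIntegral.integral_const_mul,
    intervalIntegral.integral_of_le hr.le, intervalIntegral.integral_of_le hr.le,
    integral_Ioc_eq_integral_Ioo, integral_Ioc_eq_integral_Ioo] at hmono
  set A := ∫ t in Set.Ioo 0 r, t ^ j * v t ^ 2
  set B := ∫ t in Set.Ioo 0 r, t ^ (j + 2) * v' t ^ 2
  have hj : (0 : ℝ) < (j : ℝ) + 1 := by positivity
  have h2 := mul_le_mul_of_nonneg_left hmono (show 0 ≤ 2 / ((j : ℝ) + 1) by positivity)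
  have e2 : 2 / ((j : ℝ) + 1) * (((j : ℝ) + 1) / 2 * A - 2 / ((j : ℝ) + 1) * B) =
      A - 4 / ((j : ℝ) + 1) ^ 2 * B := by
    field_simp
    ring
  linarith

section Polar

variable {E : Type*} [NormedAddCommGroup E] [NormedSpace ℝ E] [MeasurableSpace E] [BorelSpace E]
  [FiniteDimensional ℝ E] [Nontrivial E] (μ : Measure E) [μ.IsAddHaarMeasure]

theorem integral_volumeIoiPow (k : ℕ) (g : ℝ → ℝ) :
    ∫ t : Set.Ioi (0 : ℝ), g t ∂(Measure.volumeIoiPow k) = ∫ t in Set.Ioi 0, t ^ k * g t := by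
  simp only [Measure.volumeIoiPow, ENNReal.ofReal]
  rw [integral_withDensity_eq_integral_smul,
    integral_subtype_comap measurableSet_Ioi fun a ↦ Real.toNNReal (a ^ k) • g a,
    setIntegral_congr_fun measurableSet_Ioi fun x hx ↦ ?_]
  · rw [NNReal.smul_def, Real.coe_toNNReal _ (pow_nonneg (le_of_lt hx) _), smul_eq_mul]
  · exact (measurable_subtype_coe.pow_const _).real_toNNReal

/-- Polar coordinates on a ball. -/
theorem integral_ball_eq_integral_toSphere {r : ℝ} {f : E → ℝ}
    (hf : IntegrableOn f (Metric.ball 0 r) μ) :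
    Integrable (fun ω : Metric.sphere (0 : E) 1 => ∫ t in Set.Ioo 0 r,
      t ^ (Module.finrank ℝ E - 1) * f (t • (ω : E))) μ.toSphere ∧
    ∫ x in Metric.ball 0 r, f x ∂μ = ∫ ω : Metric.sphere (0 : E) 1, (∫ t in Set.Ioo 0 r,
      t ^ (Module.finrank ℝ E - 1) * f (t • (ω : E))) ∂μ.toSphere := by
  set F : E → ℝ := (Metric.ball (0 : E) r).indicator f with hF
  have hFi : Integrable F μ := (integrable_indicator_iff measurableSet_ball).2 hf
  have hmp := μ.measurePreserving_homeomorphUnitSphereProd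
  have hemb := (homeomorphUnitSphereProd E).measurableEmbedding
  set G : Metric.sphere (0 : E) 1 × Set.Ioi (0 : ℝ) → ℝ := fun p => F ((p.2 : ℝ) • (p.1 : E))
  have hGF : ∀ x : ({0}ᶜ : Set E), G (homeomorphUnitSphereProd E x) = F x := by
    intro x
    have := congrArg Subtype.val ((homeomorphUnitSphereProd E).symm_apply_apply x)
    simp only [homeomorphUnitSphereProd_symm_apply_coe] at this
    simp only [G, this]
  have hGi : Integrable G (μ.toSphere.prod (Measure.volumeIoiPow (Module.finrank ℝ E - 1))) := by
    rw [← hmp.integrable_comp_emb hemb]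
    have : G ∘ homeomorphUnitSphereProd E = F ∘ Subtype.val := funext hGF
    rw [this, ← integrableOn_iff_comap_subtypeVal (measurableSet_singleton _).compl]
    exact hFi.integrableOn
  have hinner : ∀ ω : Metric.sphere (0 : E) 1,
      ∫ t, G (ω, t) ∂(Measure.volumeIoiPow (Module.finrank ℝ E - 1)) =
      ∫ t in Set.Ioo 0 r, t ^ (Module.finrank ℝ E - 1) * f (t • (ω : E)) := by
    intro ω
    rw [integral_volumeIoiPow _ fun t => F (t • (ω : E)), ← Set.Ioi_inter_Iio,
      ← setIntegral_indicator measurableSet_Iio]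
    refine setIntegral_congr_fun measurableSet_Ioi fun t ht => ?_
    have ht' : (0 : ℝ) < t := ht
    by_cases h : t < r <;>
      simp [hF, Set.indicator, norm_smul, abs_of_pos ht', h]
  have hfub := integral_prod G hGi
  have hint := hGi.integral_prod_left
  simp only [hinner] at hfub hint
  refine ⟨hint, ?_⟩
  rw [← hfub, ← hmp.integral_comp hemb, ← integral_indicator measurableSet_ball, ← hF]
  simp only [hGF]
  rw [integral_subtype_comap (measurableSet_singleton _).compl F, restrict_compl_singleton]

end Polar

theorem ofReal_mul_pow_le_volumeIoiPow (k : ℕ) {δ : ℝ} (h1 : δ < 1) :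
    ENNReal.ofReal (δ * (1 - δ) ^ k) ≤
      Measure.volumeIoiPow k (Subtype.val ⁻¹' Set.Ioo (1 - δ) 1) := by
  have hms : MeasurableSet (Subtype.val ⁻¹' Set.Ioo (1 - δ) 1 : Set (Set.Ioi (0 : ℝ))) :=
    measurable_subtype_coe measurableSet_Ioo
  have hsub : Set.Ioo (1 - δ) 1 ⊆ Set.Ioi (0 : ℝ) := fun t ht => by
    have := ht.1
    simp only [Set.mem_Ioi]
    linarith
  rw [Measure.volumeIoiPow, withDensity_apply _ hms,
    setLIntegral_subtype measurableSet_Ioi _ fun a : ℝ ↦ ENNReal.ofReal (a ^ k),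
    Subtype.image_preimage_coe, Set.inter_eq_right.2 hsub, mul_comm,
    ENNReal.ofReal_mul (pow_nonneg (by linarith) _)]
  calc ENNReal.ofReal ((1 - δ) ^ k) * ENNReal.ofReal δ
      = ∫⁻ _ in Set.Ioo (1 - δ) 1, ENNReal.ofReal ((1 - δ) ^ k) := by simp
    _ ≤ _ := setLIntegral_mono' measurableSet_Ioo fun t ht => by
      have := ht.1
      gcongr

/-- The surface measure of a subset of the unit sphere is controlled by the volume of a thin shell
over that set. -/
theorem toSphere_mul_le_of_shell_subset {E : Type*} [NormedAddCommGroup E] [NormedSpace ℝ E]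
    [MeasurableSpace E] [BorelSpace E] [FiniteDimensional ℝ E] (μ : Measure E)
    [μ.IsAddHaarMeasure] {δ : ℝ} (h1 : δ < 1) (S : Set (Metric.sphere (0 : E) 1))
    {B : Set E} (hB : ∀ y ∈ S, ∀ t ∈ Set.Ioo (1 - δ) 1, t • (y : E) ∈ B) :
    μ.toSphere S * ENNReal.ofReal (δ * (1 - δ) ^ (Module.finrank ℝ E - 1)) ≤ μ B := by
  have hmp := μ.measurePreserving_homeomorphUnitSphereProd
  have hemb := (homeomorphUnitSphereProd E).measurableEmbedding
  calc _ ≤ μ.toSphere S * Measure.volumeIoiPow (Module.finrank ℝ E - 1)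
          (Subtype.val ⁻¹' Set.Ioo (1 - δ) 1) := by
        gcongr
        exact ofReal_mul_pow_le_volumeIoiPow _ h1
    _ = μ.comap Subtype.val
          (homeomorphUnitSphereProd E ⁻¹' (S ×ˢ (Subtype.val ⁻¹' Set.Ioo (1 - δ) 1))) := by
        rw [hmp.measure_preimage_emb hemb, Measure.prod_prod]
    _ ≤ μ B := by
        rw [comap_subtype_coe_apply (measurableSet_singleton _).compl]
        refine measure_mono ?_
        rintro _ ⟨x, hx, rfl⟩
        have := congrArg Subtype.val ((homeomorphUnitSphereProd E).symm_apply_apply x)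
        simp only [homeomorphUnitSphereProd_symm_apply_coe] at this
        rw [← this]
        exact hB _ hx.1 _ hx.2

/-- Upper bound for the surface measure of a subset of the unit sphere of diameter at most `δ`. -/
theorem toSphere_le_of_dist_le {m : ℕ} {δ : ℝ} (h0 : 0 < δ) (h1 : δ < 1)
    (S : Set (Metric.sphere (0 : EuclideanSpace ℝ (Fin (m + 1))) 1))
    (hS : ∀ x ∈ S, ∀ y ∈ S, dist x y ≤ δ) :
    (volume : Measure (EuclideanSpace ℝ (Fin (m + 1)))).toSphere S *
      ENNReal.ofReal ((1 - δ) ^ m) ≤ ENNReal.ofReal (1 + δ) * ENNReal.ofReal δ ^ m := by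
  rcases S.eq_empty_or_nonempty with rfl | ⟨p, hp⟩
  · simp
  set E := EuclideanSpace ℝ (Fin (m + 1))
  obtain ⟨b, hb⟩ : ∃ b : OrthonormalBasis (Fin (m + 1)) ℝ E, b 0 = p := by
    have hv : Orthonormal ℝ (({0} : Set (Fin (m + 1))).domRestrict fun _ => (p : E)) := by
      constructor
      · intro i
        simp [Set.domRestrict]
      · intro i j hij
        exact absurd (Subsingleton.elim i j) hij
    obtain ⟨b, hb⟩ := hv.exists_orthonormalBasis_extension_of_card_eq (by simp)
    exact ⟨b, hb 0 rfl⟩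
  have hdist : ∀ x ∈ S, ∀ y ∈ S, ‖(x : E) - y‖ ≤ δ := fun x hx y hy => by
    rw [← dist_eq_norm]
    exact hS x hx y hy
  have hcoord : ∀ i, ∀ x ∈ S, ∀ y ∈ S, inner ℝ (b i) (x : E) - δ ≤ inner ℝ (b i) (y : E) := by
    intro i x hx y hy
    have h := (real_inner_le_norm (b i) ((x : E) - y)).trans
      (mul_le_mul_of_nonneg_left (hdist x hx y hy) (norm_nonneg _))
    rw [inner_sub_right, b.norm_eq_one, one_mul] at h
    linarith
  set a : Fin (m + 1) → ℝ := fun i => sInf ((fun y : Metric.sphere (0 : E) 1 =>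
    inner ℝ (b i) (y : E)) '' S)
  have halow : ∀ i, ∀ y ∈ S, a i ≤ inner ℝ (b i) (y : E) := fun i y hy =>
    csInf_le ⟨inner ℝ (b i) (p : E) - δ, by
      rintro _ ⟨y, hy, rfl⟩
      exact hcoord i p hp y hy⟩ ⟨y, hy, rfl⟩
  have hahigh : ∀ i, ∀ y ∈ S, inner ℝ (b i) (y : E) ≤ a i + δ := fun i y hy => by
    have : inner ℝ (b i) (y : E) - δ ≤ a i :=
      le_csInf ⟨_, p, hp, rfl⟩ (by
        rintro _ ⟨z, hz, rfl⟩
        exact hcoord i y hy z hz)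
    linarith
  set lo : Fin (m + 1) → ℝ := Fin.cons ((1 - δ) * (1 - δ ^ 2 / 2)) fun i : Fin m => a i.succ
  set hi : Fin (m + 1) → ℝ := Fin.cons 1 fun i : Fin m => a i.succ + δ
  have hbox : ∀ y ∈ S, ∀ t ∈ Set.Ioo (1 - δ) 1, t • (y : E) ∈
      b.repr ⁻¹' (WithLp.ofLp ⁻¹' Set.Icc lo hi) := by
    intro y hy t ht
    have ht0 : 0 ≤ t := by linarith [ht.1]
    simp only [Set.mem_preimage, Set.mem_Icc, Pi.le_def]
    rw [← forall_and]
    intro i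
    rw [b.repr_apply_apply, inner_smul_right]
    refine Fin.cases ?_ (fun i => ?_) i
    · simp only [lo, hi, Fin.cons_zero, hb]
      have h2 := norm_sub_sq_real (p : E) y
      have h3 := hdist p hp y hy
      have h4 : ‖(p : E)‖ = 1 := by simp
      have h5 : ‖(y : E)‖ = 1 := by simp
      have h6 : ‖(p : E) - y‖ ^ 2 ≤ δ ^ 2 := pow_le_pow_left₀ (norm_nonneg _) h3 2
      have h7 : inner ℝ (p : E) y ≤ 1 := by
        have := real_inner_le_norm (p : E) y
        rwa [h4, h5, one_mul] at this
      rw [h4, h5] at h2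
      have h8 : 1 - δ ^ 2 / 2 ≤ inner ℝ (p : E) y := by linarith
      have h9 : 0 ≤ 1 - δ ^ 2 / 2 := by nlinarith
      constructor
      · exact mul_le_mul ht.1.le h8 h9 ht0
      · nlinarith [ht.2]
    · simp only [lo, hi, Fin.cons_succ]
      have hp0 : inner ℝ (b i.succ) (p : E) = 0 := by
        rw [← hb]
        exact b.orthonormal.2 (Fin.succ_ne_zero i)
      have q1 := halow i.succ p hp
      have q2 := hahigh i.succ p hp
      rw [hp0] at q1 q2
      have q3 := halow i.succ y hy
      have q4 := hahigh i.succ y hy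
      have := ht.2
      constructor <;> nlinarith
  have hvol : volume (b.repr ⁻¹' (WithLp.ofLp ⁻¹' Set.Icc lo hi)) =
      ENNReal.ofReal (1 - (1 - δ) * (1 - δ ^ 2 / 2)) * ENNReal.ofReal δ ^ m := by
    rw [b.measurePreserving_repr.measure_preimage_emb
        b.repr.toHomeomorph.measurableEmbedding,
      (PiLp.volume_preserving_ofLp _).measure_preimage measurableSet_Icc.nullMeasurableSet,
      Real.volume_Icc_pi, Fin.prod_univ_succ]
    simp [lo, hi]
  have hmain := toSphere_mul_le_of_shell_subset volume h1 S hbox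
  rw [hvol, ENNReal.ofReal_mul h0.le] at hmain
  have hfin : Module.finrank ℝ E - 1 = m := by simp [E]
  rw [hfin] at hmain
  have hle : ENNReal.ofReal (1 - (1 - δ) * (1 - δ ^ 2 / 2)) ≤
      ENNReal.ofReal δ * ENNReal.ofReal (1 + δ) := by
    rw [← ENNReal.ofReal_mul h0.le]
    apply ENNReal.ofReal_le_ofReal
    nlinarith [pow_pos h0 3, pow_pos h0 2]
  have hδ : ENNReal.ofReal δ ≠ 0 := by simpa using h0
  rw [← ENNReal.mul_le_mul_iff_right hδ ENNReal.ofReal_ne_top]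
  calc _ = _ := by rw [mul_left_comm]
    _ ≤ _ := hmain
    _ ≤ _ := by
      rw [← mul_assoc]
      gcongr

/-- The Hausdorff measure (without normalizing constant) dominates the surface measure on the unit
sphere. -/
theorem toSphere_le_hausdorffMeasure (m : ℕ) :
    (volume : Measure (EuclideanSpace ℝ (Fin (m + 1)))).toSphere ≤ μH[(m : ℝ)] := by
  set σ := (volume : Measure (EuclideanSpace ℝ (Fin (m + 1)))).toSphere
  have key : ∀ ε ∈ Set.Ioo (0 : ℝ) 1,
      ENNReal.ofReal ((1 - ε) ^ m / (1 + ε)) • σ ≤ μH[(m : ℝ)] := by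
    intro ε hε
    refine Measure.le_hausdorffMeasure _ _ (ENNReal.ofReal (ε / 2)) (by simpa using hε.1) ?_
    intro S hS
    have hfin : Metric.ediam S ≠ ⊤ := ne_top_of_le_ne_top ENNReal.ofReal_ne_top hS
    have hd : Metric.diam S ≤ ε / 2 :=
      ENNReal.toReal_le_of_le_ofReal (by linarith [hε.1]) hS
    have hdist : ∀ x ∈ S, ∀ y ∈ S, dist x y ≤ Metric.diam S := fun x hx y hy =>
      Metric.dist_le_diam_of_mem' hfin hx hy
    have hb : ∀ δ ∈ Set.Ioo (Metric.diam S) ε, ENNReal.ofReal ((1 - ε) ^ m / (1 + ε)) * σ S ≤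
        ENNReal.ofReal (δ ^ m) := by
      intro δ hδ
      have h0 : 0 < δ := Metric.diam_nonneg.trans_lt hδ.1
      have h1 : δ < 1 := hδ.2.trans hε.2
      have h := toSphere_le_of_dist_le h0 h1 S fun x hx y hy => (hdist x hx y hy).trans hδ.1.le
      have h1ε : ENNReal.ofReal (1 + ε) ≠ 0 := by
        simp only [ne_eq, ENNReal.ofReal_eq_zero, not_le]
        linarith [hε.1]
      rw [← ENNReal.mul_le_mul_iff_right h1ε ENNReal.ofReal_ne_top, ← mul_assoc,
        ← ENNReal.ofReal_mul (by linarith [hε.1]), mul_div_cancel₀ _ (by linarith [hε.1]),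
        mul_comm _ (σ S)]
      calc _ ≤ σ S * ENNReal.ofReal ((1 - δ) ^ m) := by
            gcongr
            · linarith [hε.2]
            · exact hδ.2.le
        _ ≤ _ := h
        _ ≤ _ := by
            rw [ENNReal.ofReal_pow h0.le]
            gcongr
            exact hδ.2.le
    have hlim : ENNReal.ofReal ((1 - ε) ^ m / (1 + ε)) * σ S ≤
        ENNReal.ofReal (Metric.diam S ^ m) := by
      have hc : ContinuousWithinAt (fun δ : ℝ => ENNReal.ofReal (δ ^ m))
          (Set.Ioi (Metric.diam S)) (Metric.diam S) :=
        (ENNReal.continuous_ofReal.comp (continuous_pow m)).continuousWithinAt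
      refine ge_of_tendsto hc ?_
      filter_upwards [Ioo_mem_nhdsGT (show Metric.diam S < ε by linarith [hε.1])] with δ hδ
      exact hb δ hδ
    rw [Measure.smul_apply, smul_eq_mul, ENNReal.rpow_natCast]
    rwa [ENNReal.ofReal_pow Metric.diam_nonneg, Metric.diam, ENNReal.ofReal_toReal hfin] at hlim
  refine Measure.le_iff'.2 fun S => ?_
  have hc : Filter.Tendsto (fun ε : ℝ => ENNReal.ofReal ((1 - ε) ^ m / (1 + ε)) * σ S)
      (nhdsWithin 0 (Set.Ioi 0)) (nhds (σ S)) := by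
    have h1 : ContinuousAt (fun ε : ℝ => (1 - ε) ^ m / (1 + ε)) 0 := by
      apply ContinuousAt.div <;> first | fun_prop | simp
    have h2 := ENNReal.Tendsto.mul_const (b := σ S)
      (ENNReal.tendsto_ofReal (h1.tendsto.mono_left
        (nhdsWithin_le_nhds (s := Set.Ioi 0)))) (Or.inr (measure_ne_top _ _))
    simpa using h2
  refine le_of_tendsto hc ?_
  filter_upwards [Ioo_mem_nhdsGT (show (0 : ℝ) < 1 by norm_num)] with ε hε
  simpa using key ε hε S

/-- Spheres have finite Hausdorff measure: the faces of a cube, projected radially, cover them. -/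
theorem hausdorffMeasure_sphere_lt_top (m : ℕ) (r : ℝ) (hr : 0 < r) :
    μH[(m : ℝ)] (Metric.sphere (0 : EuclideanSpace ℝ (Fin (m + 1))) r) < ⊤ := by
  set E := EuclideanSpace ℝ (Fin (m + 1))
  let face : Fin (m + 1) → ℝ → (Fin m → ℝ) → E := fun i s z => WithLp.toLp 2 (i.insertNth s z)
  let g : Fin (m + 1) → ℝ → (Fin m → ℝ) → E := fun i s z => (r * ‖face i s z‖⁻¹) • face i s z
  have hface : ∀ i s, ContDiff ℝ 1 (face i s) := by
    intro i s
    refine contDiff_euclidean.2 fun j => ?_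
    rcases Fin.eq_self_or_eq_succAbove i j with rfl | ⟨k, rfl⟩
    · simpa [face] using contDiff_const
    · simpa [face] using contDiff_apply ℝ ℝ k
  have hface0 : ∀ i s z, s ≠ 0 → face i s z ≠ 0 := by
    intro i s z hs h
    have := congrArg (fun x : E => x i) h
    simp [face] at this
    exact hs this
  have hg : ∀ i s, s ≠ 0 → ContDiff ℝ 1 (g i s) := by
    intro i s hs
    refine ContDiff.smul (contDiff_const.mul (ContDiff.inv ((hface i s).norm ℝ ?_) ?_)) (hface i s)
    · exact fun z => hface0 i s z hs
    · exact fun z => norm_ne_zero_iff.2 (hface0 i s z hs)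
  have hfin : ∀ i s, s ≠ 0 → μH[(m : ℝ)] (g i s '' Metric.closedBall 0 1) < ⊤ := by
    intro i s hs
    obtain ⟨K, hK⟩ := (hg i s hs).locallyLipschitz.locallyLipschitzOn
      (s := Metric.closedBall 0 1) |>.exists_lipschitzOnWith_of_compact
      (isCompact_closedBall 0 1)
    refine (hK.hausdorffMeasure_image_le (Nat.cast_nonneg m)).trans_lt ?_
    have : (μH[(m : ℝ)] : Measure (Fin m → ℝ)) = volume := by
      simpa using hausdorffMeasure_pi_real (ι := Fin m)
    rw [this]
    exact ENNReal.mul_lt_top (ENNReal.rpow_lt_top_of_nonneg (Nat.cast_nonneg m) ENNReal.coe_ne_top)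
      (isCompact_closedBall _ _).measure_lt_top
  have hcover : Metric.sphere (0 : E) r ⊆
      ⋃ i : Fin (m + 1), (g i 1 '' Metric.closedBall 0 1 ∪ g i (-1) '' Metric.closedBall 0 1) := by
    intro x hx
    have hxr : ‖x‖ = r := by simpa using hx
    obtain ⟨i, hi⟩ := Finite.exists_max fun i => |x i|
    have hxi : x i ≠ 0 := by
      intro h0
      have : x = 0 := by
        ext j
        have := hi j
        rw [h0, abs_zero] at this
        simpa using this
      rw [this, norm_zero] at hxr
      exact hr.ne hxr
    have hpos : 0 < |x i| := abs_pos.2 hxi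
    have hmem : (fun k => x (i.succAbove k) / |x i|) ∈ Metric.closedBall (0 : Fin m → ℝ) 1 := by
      rw [mem_closedBall_zero_iff, pi_norm_le_iff_of_nonneg zero_le_one]
      intro k
      rw [Real.norm_eq_abs, abs_div, abs_abs]
      exact div_le_one_of_le₀ (hi _) hpos.le
    have hg' : ∀ s : ℝ, s * |x i| = x i →
        g i s (fun k => x (i.succAbove k) / |x i|) = x := by
      intro s hs
      have e : face i s (fun k => x (i.succAbove k) / |x i|) = |x i|⁻¹ • x := by
        ext j
        change _ = |x i|⁻¹ * x j
        rcases Fin.eq_self_or_eq_succAbove i j with rfl | ⟨k, rfl⟩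
        · simp [face]
          field_simp
          exact hs
        · simp [face]
          field_simp
      simp only [g, e, norm_smul, hxr, smul_smul, norm_inv, Real.norm_eq_abs, abs_abs]
      have : r * (|x i|⁻¹ * r)⁻¹ * |x i|⁻¹ = 1 := by field_simp
      rw [this, one_smul]
    refine Set.mem_iUnion.2 ⟨i, ?_⟩
    rcases hxi.lt_or_gt with h | h
    · exact Or.inr ⟨_, hmem, hg' _ (by rw [abs_of_neg h]; ring)⟩
    · exact Or.inl ⟨_, hmem, hg' _ (by rw [abs_of_pos h]; ring)⟩
  refine (measure_mono hcover).trans_lt ((measure_iUnion_fintype_le _ _).trans_lt ?_)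
  refine ENNReal.sum_lt_top.2 fun i _ => (measure_union_le _ _).trans_lt ?_
  exact ENNReal.add_lt_top.2 ⟨hfin i 1 one_ne_zero, hfin i (-1) (by norm_num)⟩

open scoped Pointwise in
/-- The unnormalized Hausdorff measure on a sphere of radius `r` dominates its surface measure. -/
theorem integral_toSphere_le_setIntegral_sphere {m : ℕ} {r : ℝ} (hr : 0 < r)
    {g : EuclideanSpace ℝ (Fin (m + 1)) → ℝ} (hg0 : ∀ x, 0 ≤ g x)
    (hg : ContinuousOn g (Metric.sphere 0 r)) :
    Integrable (fun ω : Metric.sphere (0 : EuclideanSpace ℝ (Fin (m + 1))) 1 =>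
      g (r • ω.1)) volume.toSphere ∧
    r ^ m * ∫ ω : Metric.sphere (0 : EuclideanSpace ℝ (Fin (m + 1))) 1,
      g (r • ω.1) ∂volume.toSphere ≤
    ∫ x in Metric.sphere 0 r, g x ∂μH[(m : ℝ)] := by
  set σ := (volume : Measure (EuclideanSpace ℝ (Fin (m + 1)))).toSphere
  set φ : Metric.sphere (0 : EuclideanSpace ℝ (Fin (m + 1))) 1 → EuclideanSpace ℝ (Fin (m + 1)) :=
    fun ω => r • ω.1
  have hφc : Continuous φ := by fun_prop
  have hrm : 0 < r ^ m := pow_pos hr m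
  have hle : ENNReal.ofReal (r ^ m) • σ.map φ ≤ μH[(m : ℝ)].restrict (Metric.sphere 0 r) := by
    refine Measure.le_iff.2 fun B hB => ?_
    rw [Measure.smul_apply, Measure.map_apply hφc.measurable hB, Measure.restrict_apply hB,
      smul_eq_mul]
    calc _ ≤ ENNReal.ofReal (r ^ m) * μH[(m : ℝ)] (φ ⁻¹' B) := by
          exact mul_le_mul_right (toSphere_le_hausdorffMeasure m _) _
      _ = ENNReal.ofReal (r ^ m) * μH[(m : ℝ)] (Subtype.val '' (φ ⁻¹' B)) := by
          rw [isometry_subtype_coe.hausdorffMeasure_image (Or.inl (Nat.cast_nonneg m))]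
      _ = μH[(m : ℝ)] (r • (Subtype.val '' (φ ⁻¹' B))) := by
          rw [Measure.hausdorffMeasure_smul₀ (Nat.cast_nonneg m) hr.ne', NNReal.rpow_natCast,
            ENNReal.smul_def, smul_eq_mul, ENNReal.coe_pow, ENNReal.ofReal_pow hr.le,
            ← Real.enorm_of_nonneg hr.le]
          rfl
      _ ≤ _ := by
          refine measure_mono ?_
          rintro _ ⟨_, ⟨ω, hω, rfl⟩, rfl⟩
          exact ⟨hω, by simp [norm_smul, abs_of_pos hr]⟩
  have hgi : Integrable g (μH[(m : ℝ)].restrict (Metric.sphere 0 r)) := by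
    have : IsFiniteMeasure
        (μH[(m : ℝ)].restrict (Metric.sphere (0 : EuclideanSpace ℝ (Fin (m + 1))) r)) :=
      ⟨by simpa using hausdorffMeasure_sphere_lt_top m r hr⟩
    obtain ⟨C, hC⟩ :=
      (isCompact_sphere (0 : EuclideanSpace ℝ (Fin (m + 1))) r).exists_bound_of_continuousOn hg
    exact Integrable.of_bound
      (hg.aestronglyMeasurable Metric.isClosed_sphere.measurableSet) C
      (ae_restrict_of_forall_mem Metric.isClosed_sphere.measurableSet hC)
  have hne : ENNReal.ofReal (r ^ m) ≠ 0 := by simpa using hrm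
  have hgi' : Integrable g (σ.map φ) :=
    (integrable_smul_measure hne ENNReal.ofReal_ne_top).1 (hgi.mono_measure hle)
  refine ⟨hgi'.comp_measurable hφc.measurable, ?_⟩
  have h := integral_mono_measure hle (Filter.Eventually.of_forall hg0) hgi
  rwa [integral_smul_measure, ENNReal.toReal_ofReal hrm.le, smul_eq_mul,
    integral_map hφc.aemeasurable hgi'.1] at h

/-- Hardy-type inequality with boundary term on a Euclidean ball, `n ≥ 3`. -/
theorem hardy_inequality_ball {n : ℕ} (hn : 3 ≤ n) (r : ℝ) (hr : 0 < r)
    (u : EuclideanSpace ℝ (Fin n) → ℝ)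
    (hu : ∃ U : Set (EuclideanSpace ℝ (Fin n)), IsOpen U ∧
      Metric.closedBall (0 : EuclideanSpace ℝ (Fin n)) r ⊆ U ∧ ContDiffOn ℝ 1 u U) :
    (∫ x in Metric.ball (0 : EuclideanSpace ℝ (Fin n)) r, u x ^ 2 / ‖x‖ ^ 2) ≤
      (2 / ((n : ℝ) - 2)) * (1 / r) *
        (∫ x in Metric.sphere (0 : EuclideanSpace ℝ (Fin n)) r, u x ^ 2 ∂μH[(n : ℝ) - 1]) +
      (4 / ((n : ℝ) - 2) ^ 2) *
        (∫ x in Metric.ball (0 : EuclideanSpace ℝ (Fin n)) r, ‖fderiv ℝ u x‖ ^ 2) := by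
  obtain ⟨U, hUo, hBU, hu⟩ := hu
  obtain ⟨j, rfl⟩ : ∃ j, n = (j + 2) + 1 := ⟨n - 3, by omega⟩
  have e1 : (((j + 2 + 1 : ℕ) : ℝ) - 2) = (j : ℝ) + 1 := by push_cast; ring
  have e2 : (((j + 2 + 1 : ℕ) : ℝ) - 1) = ((j + 2 : ℕ) : ℝ) := by push_cast; ring
  rw [e1, e2]
  have hj : (0 : ℝ) < (j : ℝ) + 1 := by positivity
  have hcu : ContinuousOn u (Metric.closedBall 0 r) := hu.continuousOn.mono hBU
  have hcd : ContinuousOn (fderiv ℝ u) (Metric.closedBall 0 r) :=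
    (hu.continuousOn_fderiv_of_isOpen hUo le_rfl).mono hBU
  by_cases hint : IntegrableOn (fun x : EuclideanSpace ℝ (Fin (j + 2 + 1)) => u x ^ 2 / ‖x‖ ^ 2)
      (Metric.ball 0 r)
  swap
  · rw [integral_undef hint]
    positivity
  have hgrad : IntegrableOn (fun x : EuclideanSpace ℝ (Fin (j + 2 + 1)) => ‖fderiv ℝ u x‖ ^ 2)
      (Metric.ball 0 r) :=
    ((hcd.norm.pow 2).integrableOn_compact (isCompact_closedBall 0 r)).mono_set
      Metric.ball_subset_closedBall
  have hdim : Module.finrank ℝ (EuclideanSpace ℝ (Fin (j + 2 + 1))) - 1 = j + 2 := by simp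
  obtain ⟨iA, hA⟩ := integral_ball_eq_integral_toSphere volume hint
  obtain ⟨iB, hB⟩ := integral_ball_eq_integral_toSphere volume hgrad
  obtain ⟨iS, hS⟩ := integral_toSphere_le_setIntegral_sphere
    (g := fun x : EuclideanSpace ℝ (Fin (j + 2 + 1)) => u x ^ 2) hr
    (fun x => sq_nonneg _) ((hcu.mono Metric.sphere_subset_closedBall).pow 2)
  rw [hdim] at iA hA iB hB
  have hray : ∀ ω : Metric.sphere (0 : EuclideanSpace ℝ (Fin (j + 2 + 1))) 1,
      ∫ t in Set.Ioo 0 r, t ^ (j + 2) * (u (t • ω.1) ^ 2 / ‖t • ω.1‖ ^ 2) ≤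
      2 / ((j : ℝ) + 1) * r ^ (j + 1) * u (r • ω.1) ^ 2 + 4 / ((j : ℝ) + 1) ^ 2 *
        ∫ t in Set.Ioo 0 r, t ^ (j + 2) * ‖fderiv ℝ u (t • ω.1)‖ ^ 2 := by
    intro ω
    have hω : ‖ω.1‖ = 1 := by simp
    have hmaps : Set.MapsTo (fun t : ℝ => t • ω.1) (Set.Icc 0 r) (Metric.closedBall 0 r) := by
      intro t ht
      simpa [norm_smul, hω, abs_of_nonneg ht.1] using ht.2
    have hcray : ContinuousOn (fun t : ℝ => fderiv ℝ u (t • ω.1)) (Set.Icc 0 r) :=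
      hcd.comp (by fun_prop) hmaps
    have hv' : ContinuousOn (fun t : ℝ => fderiv ℝ u (t • ω.1) ω) (Set.Icc 0 r) :=
      hcray.clm_apply continuousOn_const
    have hv : ∀ t ∈ Set.Icc 0 r, HasDerivAt (fun t : ℝ => u (t • ω.1))
        (fderiv ℝ u (t • ω.1) ω) t := by
      intro t ht
      have hd : DifferentiableAt ℝ u (t • ω.1) :=
        (hu.differentiableOn one_ne_zero).differentiableAt (hUo.mem_nhds (hBU (hmaps ht)))
      have hl : HasDerivAt (fun t : ℝ => t • ω.1) ω.1 t := by
        simpa using (hasDerivAt_id t).smul_const ω.1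
      exact hd.hasFDerivAt.comp_hasDerivAt t hl
    have h := radial_hardy_inequality j hr hv hv'
    have hl : ∫ t in Set.Ioo 0 r, t ^ (j + 2) * (u (t • ω.1) ^ 2 / ‖t • ω.1‖ ^ 2) =
        ∫ t in Set.Ioo 0 r, t ^ j * u (t • ω.1) ^ 2 := by
      refine setIntegral_congr_fun measurableSet_Ioo fun t ht => ?_
      have ht0 : t ≠ 0 := ht.1.ne'
      simp only [norm_smul, hω, mul_one, Real.norm_eq_abs, sq_abs]
      field_simp
      ring
    have hr' : ∫ t in Set.Ioo 0 r, t ^ (j + 2) * (fderiv ℝ u (t • ω.1) ω) ^ 2 ≤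
        ∫ t in Set.Ioo 0 r, t ^ (j + 2) * ‖fderiv ℝ u (t • ω.1)‖ ^ 2 := by
      have hcp : ContinuousOn (fun t : ℝ => t ^ (j + 2)) (Set.Icc 0 r) := by fun_prop
      refine setIntegral_mono_on
        (((hcp.mul (hv'.pow 2)).integrableOn_Icc).mono_set Set.Ioo_subset_Icc_self)
        (((hcp.mul (hcray.norm.pow 2)).integrableOn_Icc).mono_set Set.Ioo_subset_Icc_self)
        measurableSet_Ioo fun t ht => ?_
      refine mul_le_mul_of_nonneg_left ?_ (pow_nonneg ht.1.le _)
      have := (fderiv ℝ u (t • ω.1)).le_opNorm ω.1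
      rw [hω, mul_one, Real.norm_eq_abs] at this
      exact sq_le_sq' (abs_le.1 this).1 (abs_le.1 this).2
    rw [hl]
    refine h.trans ?_
    rw [mul_assoc]
    gcongr
  have hmono := integral_mono iA
    ((iS.const_mul (2 / ((j : ℝ) + 1) * r ^ (j + 1))).add (iB.const_mul (4 / ((j : ℝ) + 1) ^ 2))) hray
  simp only [Pi.add_apply] at hmono
  rw [integral_add (iS.const_mul _) (iB.const_mul _), integral_const_mul, integral_const_mul,
    ← hA, ← hB] at hmono
  refine hmono.trans ?_
  gcongr ?_ + _
  calc _ = 2 / ((j : ℝ) + 1) * (1 / r) * (r ^ (j + 2) *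
        ∫ ω : Metric.sphere (0 : EuclideanSpace ℝ (Fin (j + 2 + 1))) 1,
          u (r • ω.1) ^ 2 ∂volume.toSphere) := by
        field_simp
        ring
    _ ≤ _ := by gcongr
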